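/- arXiv:2501.13093 — 3 statements merged into one kernel-verified Lean document; each statement's English description precedes it below -/
import Mathlib

section
/- For any density parameter N_p and any positive integer K, the finite set X has a unique weakly separable K-clustering if and only if there is exactly one partition of X into K clusters each of which is a maximal cluster (i.e., exactly one dendrogram K-clustering exists). -/
variable {α : Type*}

/-- Sparsity ε_{N_p}(x): smallest ε ≥ 0 such that at least N_p points of X lie within
distance ε of x. -/
noncomputable def sparsity [MetricSpace α] (X : Finset α) (Np : ℕ) (x : α) : ℝ :=
  sInf {ε : ℝ | 0 ≤ ε ∧ Np ≤ (X.filter (fun y => dist x y ≤ ε)).card}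

/-- x is ε-connected to y: there is a finite sequence of points of X from x to y,
each of sparsity at most ε, with consecutive distances at most ε. -/
def EpsConn [MetricSpace α] (X : Finset α) (Np : ℕ) (ε : ℝ) (x y : α) : Prop :=
  x ∈ X ∧ sparsity X Np x ≤ ε ∧
    Relation.ReflTransGen (fun a b => b ∈ X ∧ sparsity X Np b ≤ ε ∧ dist a b ≤ ε) x y

/-- A set c is ε-connected if every pair of points of c is ε-connected. -/
def SetConn [MetricSpace α] (X : Finset α) (Np : ℕ) (ε : ℝ) (c : Finset α) : Prop :=
  ∀ x ∈ c, ∀ y ∈ c, EpsConn X Np ε x y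

/-- ε*(c): the minimum ε such that c is ε-connected. -/
noncomputable def setSparsity [MetricSpace α] (X : Finset α) (Np : ℕ) (c : Finset α) : ℝ :=
  sInf {ε : ℝ | SetConn X Np ε c}

/-- ε(x,y): the minimum ε such that x is ε-connected to y. -/
noncomputable def epsDist [MetricSpace α] (X : Finset α) (Np : ℕ) (x y : α) : ℝ :=
  sInf {ε : ℝ | EpsConn X Np ε x y}

/-- ε(x,c): min over y ∈ c of ε(x,y). -/
noncomputable def ptClusterDist [MetricSpace α] (X : Finset α) (Np : ℕ) (x : α)
    (c : Finset α) : ℝ :=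
  sInf {e : ℝ | ∃ y ∈ c, e = epsDist X Np x y}

/-- ε(c,c'): min over x ∈ c, y ∈ c' of ε(x,y). -/
noncomputable def clusterDist [MetricSpace α] (X : Finset α) (Np : ℕ)
    (c c' : Finset α) : ℝ :=
  sInf {e : ℝ | ∃ x ∈ c, ∃ y ∈ c', e = epsDist X Np x y}

/-- A clustering of X: a partition of X into nonempty clusters. -/
def IsClustering (X : Finset α) (C : Finset (Finset α)) : Prop :=
  (∀ c ∈ C, c.Nonempty) ∧ (∀ c ∈ C, ∀ c' ∈ C, c ≠ c' → Disjoint c c') ∧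
    (∀ c ∈ C, c ⊆ X) ∧ (∀ x ∈ X, ∃ c ∈ C, x ∈ c)

/-- C is weakly separable: for each cluster c, ε*(c) < min over c' ≠ c of ε(c,c'). -/
def WeaklySeparable [MetricSpace α] (X : Finset α) (Np : ℕ) (C : Finset (Finset α)) : Prop :=
  ∀ c ∈ C, ∀ c' ∈ C, c' ≠ c → setSparsity X Np c < clusterDist X Np c c'

/-- c is an ε-cluster: a (nonempty) maximal ε-connected subset of X. -/
def IsEpsCluster [MetricSpace α] (X : Finset α) (Np : ℕ) (ε : ℝ) (c : Finset α) : Prop :=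
  c.Nonempty ∧ SetConn X Np ε c ∧ ∀ x ∈ X, (∃ y ∈ c, EpsConn X Np ε x y) → x ∈ c

/-- c is a maximal cluster: an ε-cluster for some ε ≥ 0. -/
def IsMaximalCluster [MetricSpace α] (X : Finset α) (Np : ℕ) (c : Finset α) : Prop :=
  ∃ ε : ℝ, 0 ≤ ε ∧ IsEpsCluster X Np ε c

/-- x is a local maximum: every y ∈ X with d(x,y) ≤ ε_{N_p}(x) has sparsity ≥ that of x. -/
def IsLocalMaxPt [MetricSpace α] (X : Finset α) (Np : ℕ) (x : α) : Prop :=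
  x ∈ X ∧ ∀ y ∈ X, dist x y ≤ sparsity X Np x → sparsity X Np x ≤ sparsity X Np y

/-- X_c*: the points of c of minimum sparsity within c. -/
noncomputable def minSparsityPts [MetricSpace α] (X : Finset α) (Np : ℕ)
    (c : Finset α) : Finset α :=
  c.filter (fun x => ∀ y ∈ c, sparsity X Np x ≤ sparsity X Np y)

/-- Relative separability A(x,y) = ε(x,y) / ε_{N_p}(x). -/
noncomputable def relSep [MetricSpace α] (X : Finset α) (Np : ℕ) (x y : α) : ℝ :=
  epsDist X Np x y / sparsity X Np x

/-- A(x,c) = min over y ∈ c of A(x,y). -/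
noncomputable def relSepCluster [MetricSpace α] (X : Finset α) (Np : ℕ) (x : α)
    (c : Finset α) : ℝ :=
  sInf {a : ℝ | ∃ y ∈ c, a = relSep X Np x y}

/-- A^ℓ(C): the minimum A such that for every local maximum x, every y in the cluster of x
with sparsity at most that of x satisfies A(x,y) ≤ A. -/
noncomputable def Aell [MetricSpace α] (X : Finset α) (Np : ℕ)
    (C : Finset (Finset α)) : ℝ :=
  sInf {A : ℝ | ∀ x ∈ X, IsLocalMaxPt X Np x → ∀ c ∈ C, x ∈ c →
    ∀ y ∈ c, sparsity X Np y ≤ sparsity X Np x → relSep X Np x y ≤ A}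

/-- C is LM-separable: A^ℓ(C) < min over distinct clusters c, c' and z ∈ X_c* of A(z,c'). -/
def LMSeparable [MetricSpace α] (X : Finset α) (Np : ℕ) (C : Finset (Finset α)) : Prop :=
  ∀ c ∈ C, ∀ c' ∈ C, c ≠ c' → ∀ z ∈ minSparsityPts X Np c,
    Aell X Np C < relSepCluster X Np z c'

/-- min over x ∈ c of ε_{N_p}(x). -/
noncomputable def minSpars [MetricSpace α] (X : Finset α) (Np : ℕ) (c : Finset α) : ℝ :=
  sInf (sparsity X Np '' (c : Set α))

/-- max over x ∈ c of ε_{N_p}(x). -/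
noncomputable def maxSpars [MetricSpace α] (X : Finset α) (Np : ℕ) (c : Finset α) : ℝ :=
  sSup (sparsity X Np '' (c : Set α))

/-- C is strongly separable: there is an A such that each cluster c is
(A · min sparsity of c)-connected and A · min sparsity of c < min over c' ≠ c of ε(c,c'). -/
def StronglySeparable [MetricSpace α] (X : Finset α) (Np : ℕ)
    (C : Finset (Finset α)) : Prop :=
  ∃ A : ℝ, ∀ c ∈ C, SetConn X Np (A * minSpars X Np c) c ∧
    ∀ c' ∈ C, c' ≠ c → A * minSpars X Np c < clusterDist X Np c c'

/-- c*(x,ε): the set of points of X that are ε-connected to x. -/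
def epsClusterAt [MetricSpace α] (X : Finset α) (Np : ℕ) (ε : ℝ) (x : α) : Set α :=
  {y | EpsConn X Np ε x y}

theorem sparsity_nonneg [MetricSpace α] (X : Finset α) (Np : ℕ) (x : α) :
    0 ≤ sparsity X Np x :=
  Real.sInf_nonneg fun _ h => h.1

theorem EpsConn.symm [MetricSpace α] {X : Finset α} {Np : ℕ} {ε : ℝ} {x y : α}
    (h : EpsConn X Np ε x y) : EpsConn X Np ε y x := by
  obtain ⟨hx, hxε, hxy⟩ := h
  induction hxy with
  | refl => exact ⟨hx, hxε, .refl⟩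
  | tail _ hbc ih =>
    obtain ⟨hb, hbε, hbx⟩ := ih
    exact ⟨hbc.1, hbc.2.1, .head ⟨hb, hbε, by rw [dist_comm]; exact hbc.2.2⟩ hbx⟩

theorem EpsConn.nonneg [MetricSpace α] {X : Finset α} {Np : ℕ} {ε : ℝ} {x y : α}
    (h : EpsConn X Np ε x y) : 0 ≤ ε :=
  (sparsity_nonneg X Np x).trans h.2.1

/-- Connectivity at scale `ε` only requires comparisons between finitely many reals and `ε`. -/
theorem EpsConn.of_imp [MetricSpace α] {X : Finset α} {Np : ℕ} {ε δ : ℝ} {x y : α}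
    (hs : ∀ a ∈ X, sparsity X Np a ≤ ε → sparsity X Np a ≤ δ)
    (hd : ∀ a ∈ X, ∀ b ∈ X, dist a b ≤ ε → dist a b ≤ δ)
    (h : EpsConn X Np ε x y) : EpsConn X Np δ x y := by
  obtain ⟨hx, hxε, hxy⟩ := h
  refine ⟨hx, hs x hx hxε, ?_⟩
  suffices H : y ∈ X ∧ Relation.ReflTransGen
      (fun a b => b ∈ X ∧ sparsity X Np b ≤ δ ∧ dist a b ≤ δ) x y from H.2
  induction hxy with
  | refl => exact ⟨hx, .refl⟩
  | tail _ hbc ih =>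
    exact ⟨hbc.1, ih.2.tail ⟨hbc.1, hs _ hbc.1 hbc.2.1, hd _ ih.1 _ hbc.1 hbc.2.2⟩⟩

theorem EpsConn.mono [MetricSpace α] {X : Finset α} {Np : ℕ} {ε δ : ℝ} {x y : α}
    (h : EpsConn X Np ε x y) (hεδ : ε ≤ δ) : EpsConn X Np δ x y :=
  h.of_imp (fun _ _ h => h.trans hεδ) (fun _ _ _ _ h => h.trans hεδ)

/-- At a fixed scale `e`, all slightly larger scales give no further connections. -/
theorem exists_gt_forall_epsConn_imp [MetricSpace α] (X : Finset α) (Np : ℕ) (e : ℝ) :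
    ∃ δ > e, ∀ t < δ, ∀ x y, EpsConn X Np t x y → EpsConn X Np e x y := by
  have key (v : ℝ) : ∀ᶠ δ in nhdsWithin e (Set.Ioi e), v ≤ δ → v ≤ e := by
    rcases le_or_gt v e with h | h
    · exact .of_forall fun _ _ => h
    · filter_upwards [Ioo_mem_nhdsGT h] with δ hδ hv
      exact absurd hv hδ.2.not_ge
  have hs : ∀ᶠ δ in nhdsWithin e (Set.Ioi e),
      ∀ a ∈ X, sparsity X Np a ≤ δ → sparsity X Np a ≤ e :=
    (Filter.eventually_all_finset X).2 fun a _ => key _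
  have hd : ∀ᶠ δ in nhdsWithin e (Set.Ioi e),
      ∀ a ∈ X, ∀ b ∈ X, dist a b ≤ δ → dist a b ≤ e :=
    (Filter.eventually_all_finset X).2 fun a _ =>
      (Filter.eventually_all_finset X).2 fun b _ => key _
  obtain ⟨δ, ⟨hsδ, hdδ⟩, hδ⟩ := ((hs.and hd).and self_mem_nhdsWithin).exists
  exact ⟨δ, hδ, fun t ht x y h => (h.mono ht.le).of_imp hsδ hdδ⟩

theorem exists_forall_epsConn [MetricSpace α] (X : Finset α) (Np : ℕ) :
    ∃ M : ℝ, ∀ x ∈ X, ∀ y ∈ X, EpsConn X Np M x y := by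
  obtain ⟨M₁, h₁⟩ := (X.image (sparsity X Np)).bddAbove
  obtain ⟨M₂, h₂⟩ := ((X ×ˢ X).image fun p => dist p.1 p.2).bddAbove
  have hs (a : α) (ha : a ∈ X) : sparsity X Np a ≤ max M₁ M₂ :=
    (h₁ (Finset.mem_coe.2 (Finset.mem_image_of_mem _ ha))).trans (le_max_left _ _)
  refine ⟨max M₁ M₂, fun x hx y hy => ⟨hx, hs x hx, .single ⟨hy, hs y hy, ?_⟩⟩⟩
  exact (h₂ (Finset.mem_coe.2 (Finset.mem_image.2
    ⟨(x, y), Finset.mk_mem_product hx hy, rfl⟩))).trans (le_max_right _ _)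

theorem epsConn_epsDist [MetricSpace α] {X : Finset α} {x y : α} (Np : ℕ)
    (hx : x ∈ X) (hy : y ∈ X) : EpsConn X Np (epsDist X Np x y) x y := by
  obtain ⟨M, hM⟩ := exists_forall_epsConn X Np
  obtain ⟨δ, hδ, h⟩ := exists_gt_forall_epsConn_imp X Np (epsDist X Np x y)
  obtain ⟨t, ht, htδ⟩ := exists_lt_of_csInf_lt ⟨M, hM x hx y hy⟩ hδ
  exact h t htδ x y ht

theorem setConn_setSparsity [MetricSpace α] {X c : Finset α} (Np : ℕ)
    (hc : c ⊆ X) : SetConn X Np (setSparsity X Np c) c := by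
  obtain ⟨M, hM⟩ := exists_forall_epsConn X Np
  obtain ⟨δ, hδ, h⟩ := exists_gt_forall_epsConn_imp X Np (setSparsity X Np c)
  obtain ⟨t, ht, htδ⟩ := exists_lt_of_csInf_lt
    (s := {ε : ℝ | SetConn X Np ε c}) ⟨M, fun x hx y hy => hM x (hc hx) y (hc hy)⟩ hδ
  exact fun x hx y hy => h t htδ x y (ht x hx y hy)

theorem epsDist_nonneg [MetricSpace α] (X : Finset α) (Np : ℕ) (x y : α) :
    0 ≤ epsDist X Np x y :=
  Real.sInf_nonneg fun _ h => EpsConn.nonneg h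

theorem EpsConn.epsDist_le [MetricSpace α] {X : Finset α} {Np : ℕ} {ε : ℝ} {x y : α}
    (h : EpsConn X Np ε x y) : epsDist X Np x y ≤ ε :=
  csInf_le ⟨0, fun _ h => EpsConn.nonneg h⟩ h

theorem SetConn.setSparsity_le [MetricSpace α] {X c : Finset α} {Np : ℕ} {ε : ℝ}
    (hc : c.Nonempty) (h : SetConn X Np ε c) : setSparsity X Np c ≤ ε := by
  obtain ⟨x, hx⟩ := hc
  exact csInf_le ⟨0, fun _ h => EpsConn.nonneg (h x hx x hx)⟩ h

theorem clusterDist_le [MetricSpace α] {X c c' : Finset α} (Np : ℕ) {x y : α}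
    (hx : x ∈ c) (hy : y ∈ c') : clusterDist X Np c c' ≤ epsDist X Np x y := by
  refine csInf_le ⟨0, ?_⟩ ⟨x, hx, y, hy, rfl⟩
  rintro _ ⟨a, _, b, _, rfl⟩
  exact epsDist_nonneg X Np a b

theorem exists_clusterDist_eq [MetricSpace α] (X : Finset α) (Np : ℕ) {c c' : Finset α}
    (hc : c.Nonempty) (hc' : c'.Nonempty) :
    ∃ x ∈ c, ∃ y ∈ c', clusterDist X Np c c' = epsDist X Np x y := by
  obtain ⟨x, hx⟩ := hc
  obtain ⟨y, hy⟩ := hc'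
  refine Set.Nonempty.csInf_mem
    (s := {e : ℝ | ∃ x ∈ c, ∃ y ∈ c', e = epsDist X Np x y}) ⟨_, x, hx, y, hy, rfl⟩ ?_
  refine ((c ×ˢ c').finite_toSet.image fun p => epsDist X Np p.1 p.2).subset ?_
  rintro _ ⟨a, ha, b, hb, rfl⟩
  exact ⟨(a, b), Finset.mem_coe.2 (Finset.mk_mem_product ha hb), rfl⟩

theorem IsClustering.weaklySeparable_iff [MetricSpace α] {X : Finset α}
    {C : Finset (Finset α)} (hC : IsClustering X C) (Np : ℕ) :
    WeaklySeparable X Np C ↔ ∀ c ∈ C, IsMaximalCluster X Np c := by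
  obtain ⟨hne, hdisj, hsub, hcov⟩ := hC
  constructor
  · intro h c hc
    have hconn := setConn_setSparsity Np (hsub c hc)
    obtain ⟨z, hz⟩ := hne c hc
    refine ⟨_, (hconn z hz z hz).nonneg, ⟨z, hz⟩, hconn, ?_⟩
    rintro x hx ⟨y, hy, hxy⟩
    obtain ⟨c', hc', hxc'⟩ := hcov x hx
    by_cases hcc : c' = c
    · exact hcc ▸ hxc'
    · exact absurd ((clusterDist_le Np hy hxc').trans hxy.symm.epsDist_le)
        (h c hc c' hc' hcc).not_ge
  · intro h c hc c' hc' hcc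
    obtain ⟨ε, -, hcne, hconn, hmax⟩ := h c hc
    refine (hconn.setSparsity_le hcne).trans_lt ?_
    obtain ⟨x, hx, y, hy, hxy⟩ := exists_clusterDist_eq X Np hcne (hne c' hc')
    rw [hxy]
    by_contra! hle
    have hyX := hsub c' hc' hy
    have hconn' := (epsConn_epsDist Np (hsub c hc hx) hyX).mono hle
    exact Finset.disjoint_left.1 (hdisj c' hc' c hc hcc) hy (hmax y hyX ⟨x, hx, hconn'.symm⟩)

/-- X has a unique weakly separable K-clustering iff exactly one partition of X
into K maximal clusters exists. -/
theorem stmt_1 {α : Type*} [MetricSpace α] (X : Finset α) (Np K : ℕ)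
    (hNp : 0 < Np) (hNpX : Np ≤ X.card) (hK : 0 < K) :
    (∃! C : Finset (Finset α),
        IsClustering X C ∧ C.card = K ∧ WeaklySeparable X Np C) ↔
    (∃! C : Finset (Finset α),
        IsClustering X C ∧ C.card = K ∧ ∀ c ∈ C, IsMaximalCluster X Np c) := by
  exact existsUnique_congr fun C => and_congr_right fun hC =>
    and_congr_right fun _ => hC.weaklySeparable_iff Np
end

section
/- If C is LM-separable for N_p, c ∈ C, and z ∈ X_c*, then for every real A with 1 ≤ A ≤ A^ℓ(C), the ε-cluster centered at z with radius A·ε_{N_p}(z), namely c*(z, A·ε_{N_p}(z)), is a nonempty subset of c. -/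
variable {α : Type*}

theorem EpsConn.right_mem [MetricSpace α] {X : Finset α} {Np : ℕ} {ε : ℝ} {x y : α}
    (h : EpsConn X Np ε x y) : y ∈ X := by
  obtain ⟨hx, -, hxy⟩ := h
  cases hxy with
  | refl => exact hx
  | tail _ hb => exact hb.1

theorem relSep_nonneg [MetricSpace α] (X : Finset α) (Np : ℕ) (x y : α) :
    0 ≤ relSep X Np x y :=
  div_nonneg (Real.sInf_nonneg fun _ h => (sparsity_nonneg X Np x).trans h.2.1)
    (sparsity_nonneg X Np x)

theorem relSepCluster_le [MetricSpace α] {X : Finset α} {Np : ℕ} {x y : α} {c : Finset α}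
    (hy : y ∈ c) : relSepCluster X Np x c ≤ relSep X Np x y := by
  refine csInf_le ⟨0, ?_⟩ ⟨y, hy, rfl⟩
  rintro _ ⟨w, -, rfl⟩
  exact relSep_nonneg X Np x w

/-- for an LM-separable C, c ∈ C, z ∈ X_c*, and 1 ≤ A ≤ A^ℓ(C),
c*(z, A·ε_{N_p}(z)) is a nonempty subset of c. -/
theorem stmt_8 {α : Type*} [MetricSpace α] (X : Finset α) (Np : ℕ)
    (hNp : 2 ≤ Np) (hNpX : Np ≤ X.card)
    (C : Finset (Finset α)) (hC : IsClustering X C) (hLM : LMSeparable X Np C)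
    (c : Finset α) (hc : c ∈ C) (z : α) (hz : z ∈ minSparsityPts X Np c)
    (A : ℝ) (hA1 : 1 ≤ A) (hA2 : A ≤ Aell X Np C) :
    (epsClusterAt X Np (A * sparsity X Np z) z).Nonempty ∧
      epsClusterAt X Np (A * sparsity X Np z) z ⊆ (c : Set α) := by
  have hzc : z ∈ c := (Finset.mem_filter.mp hz).1
  have hs := sparsity_nonneg X Np z
  obtain ⟨-, -, hsub, hcover⟩ := hC
  refine ⟨⟨z, hsub c hc hzc, le_mul_of_one_le_left hs hA1, Relation.ReflTransGen.refl⟩, ?_⟩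
  intro y hy
  obtain ⟨c', hc', hyc'⟩ := hcover y (EpsConn.right_mem hy)
  by_cases hcc : c = c'
  · exact hcc ▸ hyc'
  · have hrel : relSep X Np z y ≤ A :=
      div_le_of_le_mul₀ hs (zero_le_one.trans hA1) (EpsConn.epsDist_le hy)
    have hlt := hLM c hc c' hc' hcc z hz
    have hle := relSepCluster_le (X := X) (Np := Np) (x := z) hyc'
    linarith
end

section
/- Let Ĉ be a nonempty collection of pairwise disjoint nonempty subsets of X and let Y = X \ (union of the sets in Ĉ) be nonempty. Then the minimum over x ∈ Y and c ∈ Ĉ of the ε-distance ε(x,c) equals the minimum over x ∈ Y, c ∈ Ĉ, and y ∈ c of max(d(x,y), ε_{N_p}(x), ε_{N_p}(y)). -/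
variable {α : Type*}

theorem ptClusterDist_nonneg [MetricSpace α] (X : Finset α) (Np : ℕ) (x : α) (c : Finset α) :
    0 ≤ ptClusterDist X Np x c := by
  refine Real.sInf_nonneg ?_
  rintro _ ⟨y, -, rfl⟩
  exact epsDist_nonneg X Np x y

theorem ptClusterDist_le_epsDist [MetricSpace α] (X : Finset α) (Np : ℕ) (x : α)
    {c : Finset α} {y : α} (hy : y ∈ c) : ptClusterDist X Np x c ≤ epsDist X Np x y := by
  refine csInf_le ⟨0, ?_⟩ ⟨y, hy, rfl⟩
  rintro _ ⟨z, -, rfl⟩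
  exact epsDist_nonneg X Np x z

/-- A single step connects two points of `X` at the level of their distance and sparsities. -/
theorem epsConn_max [MetricSpace α] {X : Finset α} (Np : ℕ) {x y : α} (hx : x ∈ X)
    (hy : y ∈ X) :
    EpsConn X Np (max (dist x y) (max (sparsity X Np x) (sparsity X Np y))) x y :=
  ⟨hx, (le_max_left _ _).trans (le_max_right _ _), Relation.ReflTransGen.single
    ⟨hy, (le_max_right _ _).trans (le_max_right _ _), le_max_left _ _⟩⟩

theorem epsDist_le_max [MetricSpace α] {X : Finset α} (Np : ℕ) {x y : α} (hx : x ∈ X)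
    (hy : y ∈ X) :
    epsDist X Np x y ≤ max (dist x y) (max (sparsity X Np x) (sparsity X Np y)) :=
  csInf_le ⟨0, fun _ h => EpsConn.nonneg h⟩ (epsConn_max Np hx hy)

/-- An `ε`-connection leaving a set `P` has a step from `P` to its complement. -/
theorem EpsConn.exists_crossing [MetricSpace α] {X : Finset α} {Np : ℕ} {ε : ℝ} {x y : α}
    (h : EpsConn X Np ε x y) {P : α → Prop} (hx : P x) (hy : ¬ P y) :
    ∃ a ∈ X, ∃ b ∈ X, P a ∧ ¬ P b ∧
      max (dist a b) (max (sparsity X Np a) (sparsity X Np b)) ≤ ε := by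
  obtain ⟨hxX, hxε, hpath⟩ := h
  induction hpath using Relation.ReflTransGen.head_induction_on with
  | refl => exact absurd hx hy
  | @head a b hab _ ih =>
    by_cases hb : P b
    · exact ih hb hab.1 hab.2.1
    · exact ⟨a, hxX, b, hab.1, hx, hb, max_le hab.2.2 (max_le hxε hab.2.1)⟩

/-- the minimum over unclustered x and partial clusters c of ε(x,c) equals
the minimum over x, c, and y ∈ c of max(d(x,y), ε_{N_p}(x), ε_{N_p}(y)). -/
theorem stmt_11 {α : Type*} [MetricSpace α] (X : Finset α) (Np : ℕ)
    (hNp : 0 < Np) (hNpX : Np ≤ X.card)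
    (Chat : Finset (Finset α)) (hChat : Chat.Nonempty)
    (hne : ∀ c ∈ Chat, Finset.Nonempty c) (hsub : ∀ c ∈ Chat, c ⊆ X)
    (hdisj : ∀ c ∈ Chat, ∀ c' ∈ Chat, c ≠ c' → Disjoint c c')
    (Y : Finset α) (hY : ∀ x, x ∈ Y ↔ x ∈ X ∧ ∀ c ∈ Chat, x ∉ c) (hYne : Y.Nonempty) :
    sInf {e : ℝ | ∃ x ∈ Y, ∃ c ∈ Chat, e = ptClusterDist X Np x c} =
      sInf {e : ℝ | ∃ x ∈ Y, ∃ c ∈ Chat, ∃ y ∈ c,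
        e = max (dist x y) (max (sparsity X Np x) (sparsity X Np y))} := by
  obtain ⟨c₀, hc₀⟩ := hChat
  obtain ⟨x₀, hx₀⟩ := hYne
  obtain ⟨y₀, hy₀⟩ := hne c₀ hc₀
  apply le_antisymm
  · refine le_csInf ⟨_, x₀, hx₀, c₀, hc₀, y₀, hy₀, rfl⟩ ?_
    rintro _ ⟨x, hx, c, hc, y, hy, rfl⟩
    refine le_trans (csInf_le ⟨0, ?_⟩ ⟨x, hx, c, hc, rfl⟩)
      ((ptClusterDist_le_epsDist X Np x hy).trans
        (epsDist_le_max Np ((hY x).1 hx).1 (hsub c hc hy)))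
    rintro _ ⟨z, -, c', -, rfl⟩
    exact ptClusterDist_nonneg X Np z c'
  · refine le_csInf ⟨_, x₀, hx₀, c₀, hc₀, rfl⟩ ?_
    rintro _ ⟨x, hx, c, hc, rfl⟩
    obtain ⟨w, hw⟩ := hne c hc
    refine le_csInf ⟨_, w, hw, rfl⟩ ?_
    rintro _ ⟨y, hy, rfl⟩
    refine le_csInf ⟨_, epsConn_max Np ((hY x).1 hx).1 (hsub c hc hy)⟩ fun ε hε => ?_
    obtain ⟨a, -, b, hbX, ha, hb, hab⟩ :=
      EpsConn.exists_crossing hε (P := (· ∈ Y)) hx fun h => ((hY y).1 h).2 c hc hy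
    obtain ⟨c', hc', hbc'⟩ : ∃ c' ∈ Chat, b ∈ c' := by
      by_contra! hnone
      exact hb ((hY b).2 ⟨hbX, hnone⟩)
    refine le_trans (csInf_le ⟨0, ?_⟩ ⟨a, ha, c', hc', b, hbc', rfl⟩) hab
    rintro _ ⟨z, -, _, -, u, -, rfl⟩
    exact dist_nonneg.trans (le_max_left _ _)
end
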